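/- arXiv:1201.0451 — 6 statements merged into one kernel-verified Lean document; each statement's English description precedes it below -/
import Mathlib

section
/- Let a, b, c, d, e, f be integers satisfying a + b = c + d, c − d = e + f, and a − b = e − f. Then in the ring of Laurent polynomials ℤ[Y, Y⁻¹] one has (Y^a − Y^{−a})·(Y^b − Y^{−b}) = (Y^c − Y^{−c})·(Y^d − Y^{−d}) + (Y^e − Y^{−e})·(Y^f − Y^{−f}). -/
open LaurentPolynomial

/-- The algebraic identity behind the invariance of the Block–Göttsche count under
resolving a 4-valent vertex: if `a + b = c + d`, `c - d = e + f` and `a - b = e - f`,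
then `(Y^a - Y^{-a})(Y^b - Y^{-b}) = (Y^c - Y^{-c})(Y^d - Y^{-d}) + (Y^e - Y^{-e})(Y^f - Y^{-f})`
in the ring of Laurent polynomials over `ℤ`. -/
theorem blockGoettsche_laurent_identity (a b c d e f : ℤ)
    (h1 : a + b = c + d) (h2 : c - d = e + f) (h3 : a - b = e - f) :
    ((T a : LaurentPolynomial ℤ) - T (-a)) * (T b - T (-b)) =
      (T c - T (-c)) * (T d - T (-d)) + (T e - T (-e)) * (T f - T (-f)) := by
  have expand (m n : ℤ) : ((T m : LaurentPolynomial ℤ) - T (-m)) * (T n - T (-n)) =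
      T (m + n) + T (-(m + n)) - T (m - n) - T (-(m - n)) := by
    rw [neg_add, neg_sub', sub_eq_add_neg m n, sub_neg_eq_add]
    simp only [T_add]
    ring
  rw [expand, expand, expand, h1, h2, h3]
  ring
end

section
/- Let A, B, C, D ∈ ℝ² be vertices of a convex quadrilateral in counterclockwise order, let E := A + C − B, and assume E lies in the closed triangle with vertices B, C, D. Then for every real number y > 0 one has (y^{area(B,C,D)} − y^{−area(B,C,D)})·(y^{area(A,B,D)} − y^{−area(A,B,D)}) = (y^{area(A,C,D)} − y^{−area(A,C,D)})·(y^{area(A,B,C)} − y^{−area(A,B,C)}) + (y^{area(A,D,E)} − y^{−area(A,D,E)})·(y^{area(C,D,E)} − y^{−area(C,D,E)}), where y^x denotes the real power function for y > 0, x ∈ ℝ. -/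
/-- The determinant of two vectors in `ℝ²`. -/
def det2 (u v : ℝ × ℝ) : ℝ := u.1 * v.2 - u.2 * v.1

/-- The (unsigned) Euclidean area of the triangle with vertices `P`, `Q`, `R` in `ℝ²`. -/
noncomputable def triArea (P Q R : ℝ × ℝ) : ℝ := |det2 (Q - P) (R - P)| / 2

/-- `A`, `B`, `C`, `D` are the vertices of a convex quadrilateral listed in
counterclockwise order. -/
def CcwConvexQuad (A B C D : ℝ × ℝ) : Prop :=
  0 < det2 (B - A) (C - A) ∧ 0 < det2 (C - B) (D - B) ∧
  0 < det2 (D - C) (A - C) ∧ 0 < det2 (A - D) (B - D)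

/-- Affine inequalities pass from a set to its convex hull. -/
theorem affine_le_of_mem_convexHull {s : Set (ℝ × ℝ)} {a b c : ℝ}
    (hs : ∀ X ∈ s, a * X.1 + b * X.2 ≤ c) {E : ℝ × ℝ} (hE : E ∈ convexHull ℝ s) :
    a * E.1 + b * E.2 ≤ c := by
  have hconv : Convex ℝ {X : ℝ × ℝ | a * X.1 + b * X.2 ≤ c} := by
    refine convex_halfSpace_le ⟨fun X Y => ?_, fun k X => ?_⟩ c
    · simp only [Prod.fst_add, Prod.snd_add]; ring
    · simp only [Prod.smul_fst, Prod.smul_snd, smul_eq_mul]; ring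
  exact convexHull_min hs hconv hE

theorem triArea_eq_of_det2_eq {P Q R : ℝ × ℝ} {x : ℝ} (hx : 0 ≤ x)
    (h : |det2 (Q - P) (R - P)| = |2 * x|) : triArea P Q R = x := by
  rw [triArea, h, abs_of_nonneg (by positivity)]
  ring

theorem rpow_sub_rpow_neg_mul {y : ℝ} (hy : 0 < y) (a b : ℝ) :
    (y ^ a - y ^ (-a)) * (y ^ b - y ^ (-b)) =
      y ^ (a + b) + y ^ (-(a + b)) - (y ^ (a - b) + y ^ (-(a - b))) := by
  rw [show -(a + b) = -a + -b by ring, show -(a - b) = -a + b by ring, sub_eq_add_neg a b]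
  simp only [Real.rpow_add hy]
  ring

/-- Equality of local Block–Göttsche contributions for the three resolutions of a
4-valent vertex whose dual quadrilateral is `ABCD`. -/
theorem blockGoettsche_area_identity (A B C D : ℝ × ℝ) (hq : CcwConvexQuad A B C D)
    (E : ℝ × ℝ) (hE : E = A + C - B) (hEin : E ∈ convexHull ℝ ({B, C, D} : Set (ℝ × ℝ)))
    (y : ℝ) (hy : 0 < y) :
    (y ^ triArea B C D - y ^ (-triArea B C D)) * (y ^ triArea A B D - y ^ (-triArea A B D)) =
      (y ^ triArea A C D - y ^ (-triArea A C D)) *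
        (y ^ triArea A B C - y ^ (-triArea A B C)) +
      (y ^ triArea A D E - y ^ (-triArea A D E)) *
        (y ^ triArea C D E - y ^ (-triArea C D E)) := by
  subst hE
  obtain ⟨hABC, hBCD, hCDA, hDAB⟩ := hq
  obtain ⟨a, ha⟩ : ∃ a, 2 * a = det2 (C - B) (D - B) := ⟨_, mul_div_cancel₀ _ two_ne_zero⟩
  obtain ⟨b, hb⟩ : ∃ b, 2 * b = det2 (A - D) (B - D) := ⟨_, mul_div_cancel₀ _ two_ne_zero⟩
  obtain ⟨d, hd⟩ : ∃ d, 2 * d = det2 (B - A) (C - A) := ⟨_, mul_div_cancel₀ _ two_ne_zero⟩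
  have hda : d ≤ a := by
    have h := affine_le_of_mem_convexHull (a := -(C.2 - B.2)) (b := C.1 - B.1)
      (c := 2 * a - (C.2 - B.2) * B.1 + (C.1 - B.1) * B.2) ?_ hEin
    · simp only [det2, Prod.fst_sub, Prod.snd_sub, Prod.fst_add, Prod.snd_add] at *
      linarith
    · simp only [det2, Prod.fst_sub, Prod.snd_sub] at *
      rintro X (rfl | rfl | rfl) <;> linarith
  have hdb : d ≤ b := by
    have h := affine_le_of_mem_convexHull (a := D.2 - C.2) (b := -(D.1 - C.1))
      (c := (D.2 - C.2) * C.1 - (D.1 - C.1) * C.2) ?_ hEin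
    · simp only [det2, Prod.fst_sub, Prod.snd_sub, Prod.fst_add, Prod.snd_add] at *
      linarith
    · simp only [det2, Prod.fst_sub, Prod.snd_sub] at *
      rintro X (rfl | rfl | rfl) <;> linarith
  have hd0 : 0 ≤ d := by linarith
  have eBCD : triArea B C D = a := triArea_eq_of_det2_eq (by linarith) (by rw [ha])
  have eABC : triArea A B C = d := triArea_eq_of_det2_eq hd0 (by rw [hd])
  have eABD : triArea A B D = b := by
    refine triArea_eq_of_det2_eq (by linarith) (congrArg _ ?_)
    simp only [det2, Prod.fst_sub, Prod.snd_sub] at *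
    linarith
  have eACD : triArea A C D = a + b - d := by
    refine triArea_eq_of_det2_eq (by linarith) (congrArg _ ?_)
    simp only [det2, Prod.fst_sub, Prod.snd_sub] at *
    linarith
  have eADE : triArea A D (A + C - B) = a - d := by
    refine triArea_eq_of_det2_eq (by linarith) (abs_eq_abs.mpr (Or.inr ?_))
    simp only [det2, Prod.fst_sub, Prod.snd_sub, Prod.fst_add, Prod.snd_add] at *
    linarith
  have eCDE : triArea C D (A + C - B) = b - d := by
    refine triArea_eq_of_det2_eq (by linarith) (abs_eq_abs.mpr (Or.inl ?_))
    simp only [det2, Prod.fst_sub, Prod.snd_sub, Prod.fst_add, Prod.snd_add] at *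
    linarith
  rw [eBCD, eABC, eABD, eACD, eADE, eCDE]
  simp only [rpow_sub_rpow_neg_mul hy]
  rw [show a + b - d + d = a + b by ring, show a - d + (b - d) = a + b - d - d by ring,
    show a - d - (b - d) = a - b by ring]
  ring
end

section
/- Let A, B, C, D ∈69^{} ℝ² be vertices of a convex quadrilateral in counterclockwise order, let E := A + C − B, assume E lies in the closed triangle with vertices B, C, D, and assume E ≠ D. Then area(A,C,D) > area(A,B,C). -/
/-- Barycentric coordinates of a point of a closed triangle. -/
theorem exists_barycentric_of_mem_convexHull_triple {V : Type*} [AddCommGroup V] [Module ℝ V]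
    {P Q R X : V} (hX : X ∈ convexHull ℝ ({P, Q, R} : Set V)) :
    ∃ p q r : ℝ, 0 ≤ p ∧ 0 ≤ q ∧ 0 ≤ r ∧ p + q + r = 1 ∧ p • P + q • Q + r • R = X := by
  rw [convexHull_insert (by simp), convexHull_pair, mem_convexJoin] at hX
  obtain ⟨_, rfl, _, ⟨s, t, hs, ht, hst, rfl⟩, a, b, ha, hb, hab, rfl⟩ := hX
  refine ⟨a, b * s, b * t, ha, mul_nonneg hb hs, mul_nonneg hb ht, ?_, ?_⟩
  · linear_combination hab + b * hst
  · rw [smul_add, smul_smul, smul_smul, add_assoc]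

/-- The first of the straightforward area inequalities:
`area(ACD) > area(ABC)` when `ABCD` is not a parallelogram. -/
theorem area_ACD_gt_area_ABC (A B C D : ℝ × ℝ) (hq : CcwConvexQuad A B C D)
    (E : ℝ × ℝ) (hE : E = A + C - B) (hEin : E ∈ convexHull ℝ ({B, C, D} : Set (ℝ × ℝ)))
    (hED : E ≠ D) :
    triArea A B C < triArea A C D := by
  obtain ⟨p, q, r, hp, hq₀, hr, hsum, hX⟩ := exists_barycentric_of_mem_convexHull_triple hEin
  obtain ⟨hABC, hBCD, hCDA, -⟩ := hq
  have hr_lt : r < 1 := by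
    refine lt_of_le_of_ne (by linarith) fun hr_eq => hED ?_
    obtain rfl : p = 0 := by linarith
    obtain rfl : q = 0 := by linarith
    simp [← hX, hr_eq]
  rw [hE] at hX
  have h₁ := congrArg Prod.fst hX
  have h₂ := congrArg Prod.snd hX
  simp only [Prod.fst_add, Prod.snd_add, Prod.fst_sub, Prod.snd_sub, Prod.smul_fst,
    Prod.smul_snd, smul_eq_mul] at h₁ h₂
  have hA₁ : A.1 = p * B.1 + q * C.1 + r * D.1 - C.1 + B.1 := by linarith
  have hA₂ : A.2 = p * B.2 + q * C.2 + r * D.2 - C.2 + B.2 := by linarith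
  obtain rfl : p = 1 - q - r := by linarith
  have hABC_eq : det2 (B - A) (C - A) = r * det2 (C - B) (D - B) := by
    simp only [det2, Prod.fst_sub, Prod.snd_sub, hA₁, hA₂]
    ring
  have hCDA_eq : det2 (D - C) (A - C) = (2 - q - r) * det2 (C - B) (D - B) := by
    simp only [det2, Prod.fst_sub, Prod.snd_sub, hA₁, hA₂]
    ring
  have hACD_eq : det2 (C - A) (D - A) = det2 (D - C) (A - C) := by
    simp only [det2, Prod.fst_sub, Prod.snd_sub]
    ring
  rw [triArea, triArea, hACD_eq, abs_of_pos hABC, abs_of_pos hCDA, hABC_eq, hCDA_eq]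
  gcongr
  linarith
end

section
/- Let A, B, C, D ∈ ℝ² be vertices of a convex quadrilateral in counterclockwise order, let E := A + C − B, and assume E lies in the closed triangle with vertices B, C, D. Then area(B,C,D) ≥ area(A,B,D) and area(A,D,E) ≥ area(C,D,E); moreover area(B,C,D) = area(A,B,D) if and only if B, D, E are collinear, and area(A,D,E) = area(C,D,E) if and only if B, D, E are collinear. -/
/-- Three points of the plane are collinear exactly when the determinant of two edge vectors
vanishes. -/
theorem collinear_iff_det2_eq_zero (P Q R : ℝ × ℝ) :
    Collinear ℝ ({P, Q, R} : Set (ℝ × ℝ)) ↔ det2 (Q - P) (R - P) = 0 := by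
  rw [collinear_iff_of_mem (p₀ := P) (by simp)]
  constructor
  · rintro ⟨v, hv⟩
    obtain ⟨q, hq⟩ := hv Q (by simp)
    obtain ⟨r, hr⟩ := hv R (by simp)
    subst hq hr
    simp only [det2, vadd_eq_add, add_sub_cancel_right, Prod.smul_fst, Prod.smul_snd, smul_eq_mul]
    ring
  · intro h
    simp only [det2, Prod.fst_sub, Prod.snd_sub] at h
    by_cases h1 : Q.1 - P.1 = 0
    · by_cases h2 : Q.2 - P.2 = 0
      · have hQ : Q = P := Prod.ext (sub_eq_zero.mp h1) (sub_eq_zero.mp h2)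
        refine ⟨R - P, ?_⟩
        rintro p (rfl | rfl | rfl)
        · exact ⟨0, by simp⟩
        · exact ⟨0, by simp [hQ]⟩
        · exact ⟨1, by simp⟩
      · refine ⟨Q - P, ?_⟩
        rintro p (rfl | rfl | rfl)
        · exact ⟨0, by simp⟩
        · exact ⟨1, by simp⟩
        · refine ⟨(p.2 - P.2) / (Q.2 - P.2), Prod.ext ?_ ?_⟩ <;>
            simp only [vadd_eq_add, Prod.fst_add, Prod.snd_add, Prod.smul_fst, Prod.smul_snd,
              Prod.fst_sub, Prod.snd_sub, smul_eq_mul] <;> field_simp <;> linarith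
    · refine ⟨Q - P, ?_⟩
      rintro p (rfl | rfl | rfl)
      · exact ⟨0, by simp⟩
      · exact ⟨1, by simp⟩
      · refine ⟨(p.1 - P.1) / (Q.1 - P.1), Prod.ext ?_ ?_⟩ <;>
          simp only [vadd_eq_add, Prod.fst_add, Prod.snd_add, Prod.smul_fst, Prod.smul_snd,
            Prod.fst_sub, Prod.snd_sub, smul_eq_mul] <;> field_simp <;> linarith

/-- The area inequalities `area(BCD) ≥ area(ABD)` and `area(ADE) ≥ area(CDE)`, with
equality exactly when the triangle `BDE` degenerates. -/
theorem area_inequalities_with_equality_cases (A B C D : ℝ × ℝ) (hq : CcwConvexQuad A B C D)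
    (E : ℝ × ℝ) (hE : E = A + C - B) (hEin : E ∈ convexHull ℝ ({B, C, D} : Set (ℝ × ℝ))) :
    triArea A B D ≤ triArea B C D ∧ triArea C D E ≤ triArea A D E ∧
    (triArea B C D = triArea A B D ↔ Collinear ℝ ({B, D, E} : Set (ℝ × ℝ))) ∧
    (triArea A D E = triArea C D E ↔ Collinear ℝ ({B, D, E} : Set (ℝ × ℝ))) := by
  obtain ⟨-, hs, -, -⟩ := hq
  rw [collinear_iff_det2_eq_zero]
  rw [convexHull_insert (by simp), convexHull_pair] at hEin
  simp only [convexJoin_singleton_left, Set.mem_iUnion, exists_prop] at hEin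
  obtain ⟨F, ⟨a, b, ha, hb, hab, rfl⟩, u, t, hu, ht, hut, hF⟩ := hEin
  obtain ⟨c, d, hc, hd, hcd, hEc⟩ : ∃ c d : ℝ, 0 ≤ c ∧ 0 ≤ d ∧ c + d ≤ 1 ∧
      E = B + c • (C - B) + d • (D - B) := by
    refine ⟨t * a, t * b, by positivity, by positivity, ?_, ?_⟩
    · rw [← mul_add, hab]; linarith
    · rw [← hF, eq_sub_of_add_eq hut, eq_sub_of_add_eq hab]
      module
  have hA : A = B + (c - 1) • (C - B) + d • (D - B) := by
    rw [eq_sub_iff_add_eq, hEc] at hE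
    rw [eq_sub_of_add_eq hE.symm]
    module
  generalize hS : det2 (C - B) (D - B) = S at hs
  have hABD : triArea A B D = (1 - c) * S / 2 := by
    have h : det2 (B - A) (D - A) = (1 - c) * S := by
      rw [hA, ← hS]; simp [det2]; ring
    rw [triArea, h, abs_of_nonneg (mul_nonneg (by linarith) hs.le)]
  have hBCD : triArea B C D = S / 2 := by
    rw [triArea, hS, abs_of_pos hs]
  have hCDE : triArea C D E = (1 - c - d) * S / 2 := by
    have h : det2 (D - C) (E - C) = (1 - c - d) * S := by
      rw [hEc, ← hS]; simp [det2]; ring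
    rw [triArea, h, abs_of_nonneg (mul_nonneg (by linarith) hs.le)]
  have hADE : triArea A D E = (1 - d) * S / 2 := by
    have h : det2 (D - A) (E - A) = -((1 - d) * S) := by
      rw [hEc, hA, ← hS]; simp [det2]; ring
    rw [triArea, h, abs_neg, abs_of_nonneg (mul_nonneg (by linarith) hs.le)]
  have hBDE : det2 (D - B) (E - B) = -(c * S) := by
    rw [hEc, ← hS]; simp [det2]; ring
  have hcS : 0 ≤ c * S := mul_nonneg hc hs.le
  rw [hABD, hBCD, hCDE, hADE, hBDE]
  refine ⟨by linarith, by linarith, ⟨fun h => by linarith, fun h => by linarith⟩,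
    ⟨fun h => by linarith, fun h => by linarith⟩⟩
end

section
/- Let A, B, C, D ∈ ℝ² be vertices of a convex quadrilateral in counterclockwise order, let E := A + C − B, and assume E lies in the closed triangle with vertices B, C, D. Then area(B,C,D) − area(A,D,E) = |det(B−A, C−B)|/2 = area(A,B,D) − area(C,D,E), where |det(B−A, C−B)| is the Euclidean area of the parallelogram with vertices A, B, C, E. -/
theorem exists_weights_of_mem_convexHull_triple {V : Type*} [AddCommGroup V] [Module ℝ V]
    {x y z p : V} (hp : p ∈ convexHull ℝ ({x, y, z} : Set V)) :
    ∃ a b c : ℝ, 0 ≤ a ∧ 0 ≤ b ∧ 0 ≤ c ∧ a + b + c = 1 ∧ a • x + b • y + c • z = p := by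
  rw [convexHull_insert (Set.insert_nonempty _ _), convexHull_pair, mem_convexJoin] at hp
  obtain ⟨_, rfl, _, ⟨b, c, hb, hc, hbc, rfl⟩, s, t, hs, ht, hst, rfl⟩ := hp
  refine ⟨s, t * b, t * c, hs, mul_nonneg ht hb, mul_nonneg ht hc, ?_, ?_⟩
  · rw [add_assoc, ← mul_add, hbc, mul_one, hst]
  · simp only [smul_add, smul_smul, add_assoc]

/-- Each of `area(BCD) - area(ADE)` and `area(ABD) - area(CDE)` equals half the area
of the parallelogram `ABCE`. -/
theorem area_differences_eq_half_parallelogram (A B C D : ℝ × ℝ)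
    (hq : CcwConvexQuad A B C D) (E : ℝ × ℝ) (hE : E = A + C - B)
    (hEin : E ∈ convexHull ℝ ({B, C, D} : Set (ℝ × ℝ))) :
    triArea B C D - triArea A D E = |det2 (B - A) (C - B)| / 2 ∧
    triArea A B D - triArea C D E = |det2 (B - A) (C - B)| / 2 := by
  obtain ⟨hp, hq, -, hs⟩ := hq
  obtain ⟨α, β, γ, hα, hβ, hγ, hsum, hcomb⟩ := exists_weights_of_mem_convexHull_triple hEin
  subst hE
  obtain rfl : α = 1 - β - γ := by linarith
  obtain ⟨a₁, a₂⟩ := A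
  obtain ⟨b₁, b₂⟩ := B
  obtain ⟨c₁, c₂⟩ := C
  obtain ⟨d₁, d₂⟩ := D
  simp only [Prod.smul_mk, Prod.mk_add_mk, Prod.mk_sub_mk, Prod.mk.injEq, smul_eq_mul] at hcomb
  obtain ⟨h₁, h₂⟩ := hcomb
  simp only [triArea, det2, Prod.mk_add_mk, Prod.mk_sub_mk] at hp hq hs ⊢
  set p := (b₁ - a₁) * (c₂ - a₂) - (b₂ - a₂) * (c₁ - a₁) with hp_def
  set q := (c₁ - b₁) * (d₂ - b₂) - (c₂ - b₂) * (d₁ - b₁) with hq_def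
  set s := (a₁ - d₁) * (b₂ - d₂) - (a₂ - d₂) * (b₁ - d₁) with hs_def
  have hpq : p = γ * q := by
    rw [hp_def, hq_def]
    linear_combination (c₂ - b₂) * h₁ - (c₁ - b₁) * h₂
  have hps : p = β * p + γ * s := by
    rw [hp_def, hs_def]
    linear_combination (b₂ - a₂) * h₁ - (b₁ - a₁) * h₂
  have hγ_pos : 0 < γ := pos_of_mul_pos_left (hpq ▸ hp) hq.le
  have hp_le_q : p ≤ q := by
    rw [hpq]
    exact mul_le_of_le_one_left hq.le (by linarith)
  have hp_le_s : p ≤ s := by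
    refine le_of_mul_le_mul_left ?_ hγ_pos
    nlinarith [mul_nonneg hα hp.le]
  have habd : (b₁ - a₁) * (d₂ - a₂) - (b₂ - a₂) * (d₁ - a₁) = s := by
    rw [hs_def]; ring
  have hade : (d₁ - a₁) * (a₂ + c₂ - b₂ - a₂) - (d₂ - a₂) * (a₁ + c₁ - b₁ - a₁) = p - q := by
    rw [hp_def, hq_def]; ring
  have hcde : (d₁ - c₁) * (a₂ + c₂ - b₂ - c₂) - (d₂ - c₂) * (a₁ + c₁ - b₁ - c₁) = s - p := by
    rw [hp_def, hs_def]; ring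
  have habc : (b₁ - a₁) * (c₂ - b₂) - (b₂ - a₂) * (c₁ - b₁) = p := by
    rw [hp_def]; ring
  rw [habd, hade, hcde, habc, abs_of_pos hp, abs_of_pos hq, abs_of_pos hs,
    abs_of_nonpos (sub_nonpos.2 hp_le_q), abs_of_nonneg (sub_nonneg.2 hp_le_s)]
  constructor <;> ring
end

section
/- Let A, B, C, D ∈ ℝ² be vertices of a convex quadrilateral in counterclockwise order and assume no two sides are parallel, i.e. det(B−A, D−C) ≠ 0 and det(C−B, A−D) ≠ 0. Then exactly one of the four points A+C−B, B+D−C, C+A−D, D+B−A lies in the convex hull of {A, B, C, D}, and this point lies in the interior of the convex hull. -/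
/-- The points on the left of the oriented line `XY` form a convex set. -/
lemma convex_setOf_det2_nonneg (X Y : ℝ × ℝ) :
    Convex ℝ {P : ℝ × ℝ | 0 ≤ det2 (Y - X) (P - X)} := by
  intro P hP Q hQ a b ha hb hab
  simp only [Set.mem_ofPred_eq, det2, Prod.fst_sub, Prod.snd_sub, Prod.fst_add, Prod.snd_add,
    Prod.smul_fst, Prod.smul_snd, smul_eq_mul] at *
  obtain rfl : b = 1 - a := by linarith
  linarith [mul_nonneg ha hP, mul_nonneg hb hQ]

/-- The points strictly on the left of the oriented line `XY` form an open set. -/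
lemma isOpen_setOf_det2_pos (X Y : ℝ × ℝ) :
    IsOpen {P : ℝ × ℝ | 0 < det2 (Y - X) (P - X)} := by
  unfold det2
  exact isOpen_lt (by fun_prop) (by fun_prop)

/-- A point on the left of the three sides of a positively oriented triangle lies in
the triangle. -/
lemma mem_convexHull_triangle {X Y Z P : ℝ × ℝ} (h : 0 < det2 (Y - X) (Z - X))
    (hX : 0 ≤ det2 (Z - Y) (P - Y)) (hY : 0 ≤ det2 (X - Z) (P - Z))
    (hZ : 0 ≤ det2 (Y - X) (P - X)) : P ∈ convexHull ℝ {X, Y, Z} := by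
  set d := det2 (Y - X) (Z - X) with hd
  have hP : P = (det2 (Z - Y) (P - Y) / d) • X + (det2 (X - Z) (P - Z) / d) • Y +
      (det2 (Y - X) (P - X) / d) • Z := by
    ext <;> simp only [Prod.fst_add, Prod.snd_add, Prod.smul_fst, Prod.smul_snd, smul_eq_mul] <;>
      field_simp <;> simp only [hd, det2, Prod.fst_sub, Prod.snd_sub] <;> ring
  have hsum : det2 (Z - Y) (P - Y) / d + det2 (X - Z) (P - Z) / d +
      det2 (Y - X) (P - X) / d = 1 := by
    field_simp
    simp only [hd, det2, Prod.fst_sub, Prod.snd_sub]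
    ring
  have hmem := (convex_convexHull ℝ ({X, Y, Z} : Set (ℝ × ℝ))).sum_mem (t := Finset.univ)
    (w := ![det2 (Z - Y) (P - Y) / d, det2 (X - Z) (P - Z) / d, det2 (Y - X) (P - X) / d])
    (z := ![X, Y, Z])
    (by intro i _; fin_cases i <;> simp <;> positivity)
    (by simpa [Fin.sum_univ_three] using hsum)
    (by intro i _; apply subset_convexHull; fin_cases i <;> simp)
  rw [hP]
  simpa [Fin.sum_univ_three] using hmem

lemma insert_rotate {α : Type*} (a b c d : α) : ({b, c, d, a} : Set α) = {a, b, c, d} := by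
  ext
  simp only [Set.mem_insert_iff, Set.mem_singleton_iff]
  tauto

lemma CcwConvexQuad.rotate {A B C D : ℝ × ℝ} (h : CcwConvexQuad A B C D) :
    CcwConvexQuad B C D A :=
  ⟨h.2.1, h.2.2.1, h.2.2.2, h.1⟩

/-- A point of a convex quadrilateral is on the left of its first side. -/
lemma CcwConvexQuad.det2_nonneg {A B C D P : ℝ × ℝ} (h : CcwConvexQuad A B C D)
    (hP : P ∈ convexHull ℝ ({A, B, C, D} : Set (ℝ × ℝ))) : 0 ≤ det2 (B - A) (P - A) := by
  refine convexHull_min ?_ (convex_setOf_det2_nonneg A B) hP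
  obtain ⟨h₁, -, -, h₄⟩ := h
  simp only [det2, Prod.fst_sub, Prod.snd_sub] at h₁ h₄
  rintro X (rfl | rfl | rfl | rfl) <;>
    simp only [Set.mem_ofPred_eq, det2, Prod.fst_sub, Prod.snd_sub] <;> linarith

/-- A point strictly on the left of all sides of a convex quadrilateral is interior to it. -/
lemma CcwConvexQuad.mem_interior_convexHull {A B C D P : ℝ × ℝ} (h : CcwConvexQuad A B C D)
    (h₁ : 0 < det2 (B - A) (P - A)) (h₂ : 0 < det2 (C - B) (P - B))
    (h₃ : 0 < det2 (D - C) (P - C)) (h₄ : 0 < det2 (A - D) (P - D)) :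
    P ∈ interior (convexHull ℝ ({A, B, C, D} : Set (ℝ × ℝ))) := by
  refine mem_interior.2 ⟨_, ?_, (((isOpen_setOf_det2_pos A B).inter
    (isOpen_setOf_det2_pos B C)).inter (isOpen_setOf_det2_pos C D)).inter
    (isOpen_setOf_det2_pos D A), ⟨⟨⟨h₁, h₂⟩, h₃⟩, h₄⟩⟩
  rintro Q ⟨⟨⟨q₁, q₂⟩, q₃⟩, q₄⟩
  simp only [Set.mem_ofPred_eq] at q₁ q₂ q₃ q₄
  rcases le_total 0 (det2 (A - C) (Q - C)) with hQ | hQ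
  · refine convexHull_mono ?_ (mem_convexHull_triangle h.1 q₂.le hQ q₁.le)
    intro X hX
    simp only [Set.mem_insert_iff, Set.mem_singleton_iff] at hX ⊢
    tauto
  · have hQ' : 0 ≤ det2 (C - A) (Q - A) := by
      simp only [det2, Prod.fst_sub, Prod.snd_sub] at hQ ⊢
      linarith
    refine convexHull_mono ?_ (mem_convexHull_triangle h.2.2.1 q₄.le hQ' q₃.le)
    intro X hX
    simp only [Set.mem_insert_iff, Set.mem_singleton_iff] at hX ⊢
    tauto

/-- If the fourth vertex of the parallelogram built on the sides at `B` lies in the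
quadrilateral, then it is on the left of the two sides at `D`. -/
lemma CcwConvexQuad.det2_nonneg_of_add_sub_mem {A B C D : ℝ × ℝ} (h : CcwConvexQuad A B C D)
    (hP : A + C - B ∈ convexHull ℝ ({A, B, C, D} : Set (ℝ × ℝ))) :
    0 ≤ det2 (B - A) (D - C) ∧ det2 (C - B) (A - D) ≤ 0 := by
  have hCD := h.rotate.rotate.det2_nonneg (P := A + C - B)
    (by rwa [insert_rotate, insert_rotate])
  have hDA := h.rotate.rotate.rotate.det2_nonneg (P := A + C - B)
    (by rwa [← insert_rotate])
  simp only [det2, Prod.fst_sub, Prod.snd_sub, Prod.fst_add, Prod.snd_add] at hCD hDA ⊢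
  constructor <;> linarith

lemma CcwConvexQuad.add_sub_mem_interior {A B C D : ℝ × ℝ} (h : CcwConvexQuad A B C D)
    (h₁ : 0 < det2 (B - A) (D - C)) (h₂ : det2 (C - B) (A - D) < 0) :
    A + C - B ∈ interior (convexHull ℝ ({A, B, C, D} : Set (ℝ × ℝ))) := by
  have hABC := h.1
  simp only [det2, Prod.fst_sub, Prod.snd_sub] at hABC h₁ h₂
  apply h.mem_interior_convexHull <;>
    simp only [det2, Prod.fst_sub, Prod.snd_sub, Prod.fst_add, Prod.snd_add] <;> linarith

/-- The fourth vertex of the parallelogram at `B` lies in the quadrilateral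
exactly for one choice of signs of the determinants of opposite sides. -/
lemma CcwConvexQuad.add_sub_mem_iff {A B C D : ℝ × ℝ} (h : CcwConvexQuad A B C D)
    (hpar1 : det2 (B - A) (D - C) ≠ 0) (hpar2 : det2 (C - B) (A - D) ≠ 0) :
    A + C - B ∈ convexHull ℝ ({A, B, C, D} : Set (ℝ × ℝ)) ↔
      0 < det2 (B - A) (D - C) ∧ det2 (C - B) (A - D) < 0 := by
  refine ⟨fun hP ↦ ?_, fun hs ↦ interior_subset (h.add_sub_mem_interior hs.1 hs.2)⟩
  obtain ⟨h₁, h₂⟩ := h.det2_nonneg_of_add_sub_mem hP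
  exact ⟨h₁.lt_of_ne' hpar1, h₂.lt_of_ne hpar2⟩

/-- For a convex quadrilateral `ABCD` with no two sides parallel, exactly one of the four
points `A+C-B`, `B+D-C`, `C+A-D`, `D+B-A` (the fourth vertices of the parallelograms
built on two adjacent sides) lies in the quadrilateral, and it lies in its interior. -/
theorem unique_inscribed_parallelogram (A B C D : ℝ × ℝ) (hq : CcwConvexQuad A B C D)
    (hpar1 : det2 (B - A) (D - C) ≠ 0) (hpar2 : det2 (C - B) (A - D) ≠ 0) :
    (∃! j : Fin 4, ![A + C - B, B + D - C, C + A - D, D + B - A] j ∈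
      convexHull ℝ ({A, B, C, D} : Set (ℝ × ℝ))) ∧
    (∀ j : Fin 4, ![A + C - B, B + D - C, C + A - D, D + B - A] j ∈
        convexHull ℝ ({A, B, C, D} : Set (ℝ × ℝ)) →
      ![A + C - B, B + D - C, C + A - D, D + B - A] j ∈
        interior (convexHull ℝ ({A, B, C, D} : Set (ℝ × ℝ)))) := by
  have hneg (u v : ℝ × ℝ) : det2 u v = -det2 v u := by unfold det2; ring
  have hpar1' : det2 (D - C) (B - A) ≠ 0 := by rwa [hneg, neg_ne_zero]
  have hpar2' : det2 (A - D) (C - B) ≠ 0 := by rwa [hneg, neg_ne_zero]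
  have hB := hq.add_sub_mem_iff hpar1 hpar2
  have hC := hq.rotate.add_sub_mem_iff hpar2 hpar1'
  have hD := hq.rotate.rotate.add_sub_mem_iff hpar1' hpar2'
  have hA := hq.rotate.rotate.rotate.add_sub_mem_iff hpar2' hpar1
  have iB := hq.add_sub_mem_interior
  have iC := hq.rotate.add_sub_mem_interior
  have iD := hq.rotate.rotate.add_sub_mem_interior
  have iA := hq.rotate.rotate.rotate.add_sub_mem_interior
  rw [hneg (D - C) (B - A)] at hC hD iC iD
  rw [hneg (A - D) (C - B)] at hD hA iD iA
  rw [insert_rotate A B C D] at hC iC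
  rw [insert_rotate B C D A, insert_rotate A B C D] at hD iD
  rw [insert_rotate C D A B, insert_rotate B C D A, insert_rotate A B C D] at hA iA
  simp only [neg_lt_zero, neg_pos] at hC hD hA iC iD iA
  constructor
  · rcases lt_or_gt_of_ne hpar1 with h₁ | h₁ <;> rcases lt_or_gt_of_ne hpar2 with h₂ | h₂
    · refine ⟨3, hA.2 ⟨h₂, h₁⟩, fun j hj ↦ ?_⟩
      fin_cases j <;> simp [hA, hB, hC, hD] at hj ⊢ <;> linarith
    · refine ⟨2, hD.2 ⟨h₁, h₂⟩, fun j hj ↦ ?_⟩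
      fin_cases j <;> simp [hA, hB, hC, hD] at hj ⊢ <;> linarith
    · refine ⟨0, hB.2 ⟨h₁, h₂⟩, fun j hj ↦ ?_⟩
      fin_cases j <;> simp [hA, hB, hC, hD] at hj ⊢ <;> linarith
    · refine ⟨1, hC.2 ⟨h₂, h₁⟩, fun j hj ↦ ?_⟩
      fin_cases j <;> simp [hA, hB, hC, hD] at hj ⊢ <;> linarith
  · intro j hj
    fin_cases j
    · exact iB (hB.1 hj).1 (hB.1 hj).2
    · exact iC (hC.1 hj).1 (hC.1 hj).2
    · exact iD (hD.1 hj).1 (hD.1 hj).2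
    · exact iA (hA.1 hj).1 (hA.1 hj).2
end
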